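/- Let b : [-1,1] → ℂ be a function such that θ ↦ b(cos θ) is integrable on [0,π] (equivalently, b(x)/√(1-x²) is integrable on [-1,1]). For n ∈ ℤ define c_n = (1/π)∫_{0}^{π} b(cos θ)·sin(nθ) dθ (these are the Fourier coefficients of c(e^{iθ}) = i·sign(θ)·b(cos θ), -π < θ < π; note c_{-n} = -c_n), and for n ≥ 1 define the moments b_n = (1/π)∫_{0}^{π} b(cos θ)(2cos θ)^{n-1} sin θ dθ (equal to (1/π)∫_{-1}^{1} b(x)(2x)^{n-1}dx). Then for every N ≥ 1, det(c_{j-k})_{j,k=0}^{2N-1} = (det(b_{1+j+k})_{j,k=0}^{N-1})². -/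

import Mathlib

open Real intervalIntegral

section ChebyshevS

open Polynomial Polynomial.Chebyshev

variable {R : Type*} [CommRing R]

theorem Polynomial.Chebyshev.monic_S_natCast_and_natDegree [Nontrivial R] (n : ℕ) :
    (S R n).Monic ∧ (S R n).natDegree = n := by
  induction n using Nat.strong_induction_on with
  | _ n ih =>
    match n with
    | 0 => simp
    | 1 => simp [monic_X]
    | n + 2 =>
      obtain ⟨hm₀, hd₀⟩ := ih n (by omega)
      obtain ⟨hm₁, hd₁⟩ := ih (n + 1) (by omega)
      have hm : (X * S R (n + 1 : ℕ)).Monic := monic_X.mul hm₁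
      have hd : (X * S R (n + 1 : ℕ)).natDegree = n + 2 := by
        rw [monic_X.natDegree_mul hm₁, hd₁, natDegree_X]; omega
      have hlt : (S R n).natDegree < (X * S R (n + 1 : ℕ)).natDegree := by omega
      have hS : S R (n + 2 : ℕ) = X * S R (n + 1 : ℕ) - S R n := by
        push_cast; exact S_add_two R n
      rw [hS]
      exact ⟨hm.sub_of_left (degree_lt_degree hlt),
        (natDegree_sub_eq_left_of_natDegree_lt hlt).trans hd⟩

theorem Polynomial.Chebyshev.degree_S_natCast_sub_one_lt [Nontrivial R] (n : ℕ) :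
    (S R (n - 1)).degree < (S R n).degree := by
  cases n with
  | zero => simp
  | succ n =>
    refine degree_lt_degree ?_
    rw [(monic_S_natCast_and_natDegree (n + 1)).2]
    simp [(monic_S_natCast_and_natDegree (R := R) n).2]

theorem Polynomial.Chebyshev.S_add_S_mul_S_sub_S (m k : ℤ) :
    (S R k + S R (k - 1)) * (S R m - S R (m - 1)) = S R (m + k) + S R (k - m - 1) := by
  induction m using Polynomial.Chebyshev.induct generalizing k with
  | zero => simp
  | one =>
    have h₁ := S_add_two R (k - 1)
    have h₂ := S_add_two R (k - 2)
    ring_nf at h₁ h₂ ⊢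
    simp only [S_one, S_zero]
    linear_combination -h₁ - h₂
  | add_two n ih₁ ih₀ =>
    have h₁ := S_add_two R (n : ℤ)
    have h₂ := S_add_two R (n - 1 : ℤ)
    have h₃ := S_add_two R (n + k : ℤ)
    have h₄ := S_add_two R (k - n - 3 : ℤ)
    have h₅ := ih₁ k
    have h₆ := ih₀ k
    ring_nf at h₁ h₂ h₃ h₄ h₅ h₆ ⊢
    linear_combination (S R k + S R (-1 + k)) * (h₁ - h₂) + X * h₅ - h₆ - h₃ - h₄
  | neg_add_one n ih₀ ih₁ =>
    have h₁ := S_add_two R (-n - 1 : ℤ)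
    have h₂ := S_add_two R (-n - 2 : ℤ)
    have h₃ := S_add_two R (-n - 1 + k : ℤ)
    have h₄ := S_add_two R (k + n - 2 : ℤ)
    have h₅ := ih₁ k
    have h₆ := ih₀ k
    ring_nf at h₁ h₂ h₃ h₄ h₅ h₆ ⊢
    linear_combination (S R k + S R (-1 + k)) * (h₁ - h₂) + X * h₆ - h₅ - h₃ - h₄

end ChebyshevS

section Determinants

open Polynomial

variable {R : Type*} [CommRing R]

theorem Matrix.det_fromBlocks_neg_neg {n : Type*} [Fintype n] [DecidableEq n]
    (A B : Matrix n n R) :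
    (fromBlocks A B (-B) (-A)).det = (A - B).det * (-(A + B)).det := by
  have h : fromBlocks 1 1 0 1 * fromBlocks A B (-B) (-A) * fromBlocks 1 1 0 1
      = fromBlocks (A - B) 0 (-B) (-(A + B)) := by
    simp only [fromBlocks_multiply, Matrix.one_mul, Matrix.mul_one, Matrix.zero_mul,
      Matrix.mul_zero, fromBlocks_inj]
    refine ⟨?_, ?_, ?_, ?_⟩ <;> abel
  simpa [det_fromBlocks_zero₂₁, det_fromBlocks_zero₁₂] using congrArg det h

/-- The reindexing of `Fin (2 * N)` splitting it at the middle, with the lower half reversed. -/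
def finSumFinMiddleEquiv (N : ℕ) : Fin N ⊕ Fin N ≃ Fin (2 * N) :=
  (Equiv.sumComm _ _).trans <| (Equiv.sumCongr Fin.revPerm (Equiv.refl _)).trans <|
    finSumFinEquiv.trans (finCongr (two_mul N).symm)

theorem finSumFinMiddleEquiv_inl (N : ℕ) (m : Fin N) :
    ((finSumFinMiddleEquiv N (Sum.inl m) : ℕ) : ℤ) = N + m := by
  simp [finSumFinMiddleEquiv, add_comm]

theorem finSumFinMiddleEquiv_inr (N : ℕ) (m : Fin N) :
    ((finSumFinMiddleEquiv N (Sum.inr m) : ℕ) : ℤ) = N - 1 - m := by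
  simp [finSumFinMiddleEquiv]
  omega

theorem Matrix.det_toeplitz_of_odd (c : ℤ → R) (hc : ∀ n, c (-n) = -c n) (N : ℕ) :
    (Matrix.of fun j k : Fin (2 * N) => c ((j : ℤ) - (k : ℤ))).det
      = (Matrix.of fun m k : Fin N => c (m + k + 1) + c (k - m)).det ^ 2 := by
  set A : Matrix (Fin N) (Fin N) R := Matrix.of fun m k => c (m - k)
  set B : Matrix (Fin N) (Fin N) R := Matrix.of fun m k => c (m + k + 1)
  have hT : (Matrix.of fun j k : Fin (2 * N) => c ((j : ℤ) - (k : ℤ))).submatrix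
      (finSumFinMiddleEquiv N) (finSumFinMiddleEquiv N) = fromBlocks A B (-B) (-A) := by
    ext (m | m) (k | k) <;>
      simp only [submatrix_apply, of_apply, finSumFinMiddleEquiv_inl, finSumFinMiddleEquiv_inr,
        fromBlocks_apply₁₁, fromBlocks_apply₁₂, fromBlocks_apply₂₁, fromBlocks_apply₂₂,
        neg_apply, A, B, ← hc] <;> congr 1 <;> ring
  have hD : (Matrix.of fun m k : Fin N => c (m + k + 1) + c (k - m)) = -(A - B) := by
    ext m k
    simp only [of_apply, neg_apply, sub_apply, A, B]
    rw [← neg_sub (m : ℤ) k, hc]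
    ring
  have hD' : -(A + B) = (A - B).transpose := by
    ext m k
    simp only [of_apply, neg_apply, sub_apply, add_apply, transpose_apply, A, B]
    rw [← neg_sub (m : ℤ) k, hc, add_comm (k : ℤ)]
    ring
  rw [← det_submatrix_equiv_self (finSumFinMiddleEquiv N), hT, det_fromBlocks_neg_neg, hD, hD',
    det_transpose, det_neg, mul_pow, ← pow_mul, mul_comm _ 2, pow_mul]
  simp [sq]

theorem Polynomial.apply_mul_eq_sum_coeff (L : R[X] →ₗ[R] R) {n : ℕ} {p q : R[X]}
    (hp : p.natDegree < n) (hq : q.natDegree < n) :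
    L (p * q) = ∑ i : Fin n, ∑ j : Fin n,
      p.coeff i * L (X ^ ((i : ℕ) + (j : ℕ))) * q.coeff j := by
  conv_lhs => rw [p.as_sum_range' n hp, q.as_sum_range' n hq]
  simp only [Finset.sum_mul_sum, monomial_mul_monomial, map_sum, Finset.sum_range]
  refine Finset.sum_congr rfl fun i _ => Finset.sum_congr rfl fun j _ => ?_
  rw [← mul_one (p.coeff i * q.coeff j), ← smul_eq_mul, ← smul_monomial, map_smul,
    monomial_one_right_eq_X_pow, smul_eq_mul]
  ring

/-- Replacing monomials by monic polynomials of the same degrees does not change the determinant of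
the moment matrix of a linear functional. -/
theorem Polynomial.det_moments_eq (L : R[X] →ₗ[R] R) {n : ℕ} (p q : Fin n → R[X])
    (hp : ∀ i, (p i).natDegree = i) (hpm : ∀ i, (p i).Monic)
    (hq : ∀ i, (q i).natDegree = i) (hqm : ∀ i, (q i).Monic) :
    (Matrix.of fun i j => L (p i * q j)).det
      = (Matrix.of fun i j : Fin n => L (X ^ ((i : ℕ) + (j : ℕ)))).det := by
  have h : (Matrix.of fun i j => L (p i * q j))
      = (Matrix.of fun i j : Fin n => (p j).coeff i).transpose
        * (Matrix.of fun i j : Fin n => L (X ^ ((i : ℕ) + (j : ℕ))))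
        * Matrix.of fun i j : Fin n => (q j).coeff i := by
    ext i j
    simp only [Matrix.of_apply, Matrix.mul_apply, Matrix.transpose_apply, Finset.sum_mul]
    rw [apply_mul_eq_sum_coeff L ((hp i).trans_lt i.2) ((hq j).trans_lt j.2), Finset.sum_comm]
  rw [h, Matrix.det_mul, Matrix.det_mul, Matrix.det_transpose,
    Matrix.det_matrixOfPolynomials p hp hpm, Matrix.det_matrixOfPolynomials q hq hqm,
    one_mul, mul_one]

open Polynomial.Chebyshev in
theorem Matrix.det_toeplitz_chebyshev_S [Nontrivial R] (L : R[X] →ₗ[R] R) (N : ℕ) :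
    (Matrix.of fun j k : Fin (2 * N) => L (S R ((j : ℤ) - (k : ℤ) - 1))).det
      = (Matrix.of fun j k : Fin N => L (X ^ ((j : ℕ) + (k : ℕ)))).det ^ 2 := by
  have hodd (n : ℤ) : L (S R (-n - 1)) = -L (S R (n - 1)) := by rw [S_neg_sub_one, map_neg]
  rw [det_toeplitz_of_odd (fun n => L (S R (n - 1))) hodd,
    ← det_moments_eq L (fun m : Fin N => S R (m : ℕ) - S R ((m : ℕ) - 1))
      (fun k : Fin N => S R (k : ℕ) + S R ((k : ℕ) - 1))
      (fun i => (natDegree_eq_of_degree_eq (degree_sub_eq_left_of_degree_lt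
        (degree_S_natCast_sub_one_lt _))).trans (monic_S_natCast_and_natDegree _).2)
      (fun i => (monic_S_natCast_and_natDegree _).1.sub_of_left (degree_S_natCast_sub_one_lt _))
      (fun i => (natDegree_eq_of_degree_eq (degree_add_eq_left_of_degree_lt
        (degree_S_natCast_sub_one_lt _))).trans (monic_S_natCast_and_natDegree _).2)
      (fun i => (monic_S_natCast_and_natDegree _).1.add_of_left (degree_S_natCast_sub_one_lt _))]
  congr 2
  ext m k
  simp only [of_apply]
  rw [mul_comm, S_add_S_mul_S_sub_S, map_add, add_sub_cancel_right]

end Determinants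

/-- The linear functional `p ↦ (1 / π) ∫_0^π b (cos θ) p (2 cos θ) sin θ dθ` on polynomials. -/
noncomputable def cosMomentFunctional (b : ℝ → ℂ)
    (hint : IntervalIntegrable (fun θ : ℝ => b (Real.cos θ)) MeasureTheory.volume 0 π) :
    Polynomial ℂ →ₗ[ℂ] ℂ where
  toFun p := (1 / (π : ℂ)) * ∫ θ in (0:ℝ)..π,
    b (Real.cos θ) * (p.eval (2 * (Real.cos θ : ℂ)) * (Real.sin θ : ℂ))
  map_add' p q := by
    have hi (p : Polynomial ℂ) : IntervalIntegrable (fun θ : ℝ => b (Real.cos θ) *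
        (p.eval (2 * (Real.cos θ : ℂ)) * (Real.sin θ : ℂ))) MeasureTheory.volume 0 π :=
      hint.mul_continuousOn (Continuous.continuousOn (by fun_prop))
    simp only [← mul_add, ← integral_add (hi p) (hi q), Polynomial.eval_add, add_mul]
  map_smul' a p := by
    simp only [Polynomial.eval_smul, smul_eq_mul, RingHom.id_apply, mul_assoc,
      mul_left_comm _ a, integral_const_mul]

/-- Let `b : [-1,1] → ℂ` be such that `θ ↦ b (cos θ)` is integrable on
`[0, π]`.  With `c n = (1/π) ∫_0^π b (cos θ) sin (nθ) dθ` (`n ∈ ℤ`) and moments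
`bm n = (1/π) ∫_0^π b (cos θ) (2 cos θ)^{n-1} sin θ dθ` (`n ≥ 1`), for every `N ≥ 1` we have
`det T_{2N}(c) = (det H_N[b])²`. -/
theorem statement12 (b : ℝ → ℂ)
    (hint : IntervalIntegrable (fun θ : ℝ => b (Real.cos θ)) MeasureTheory.volume 0 π)
    (c : ℤ → ℂ)
    (hc : ∀ n : ℤ,
      c n = (1 / (π : ℂ)) * ∫ θ in (0:ℝ)..π, b (Real.cos θ) * (Real.sin (n * θ) : ℂ))
    (bm : ℕ → ℂ)
    (hbm : ∀ n : ℕ, 1 ≤ n →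
      bm n = (1 / (π : ℂ)) * ∫ θ in (0:ℝ)..π,
        b (Real.cos θ) * (2 * (Real.cos θ : ℂ)) ^ (n - 1) * (Real.sin θ : ℂ))
    (N : ℕ) (hN : 1 ≤ N) :
    Matrix.det (Matrix.of fun j k : Fin (2 * N) => c ((j : ℤ) - (k : ℤ)))
      = (Matrix.det (Matrix.of fun j k : Fin N => bm (1 + (j : ℕ) + (k : ℕ)))) ^ 2 := by
  have hc' (n : ℤ) : c n = cosMomentFunctional b hint (Polynomial.Chebyshev.S ℂ (n - 1)) := by
    simp only [hc, cosMomentFunctional, LinearMap.coe_mk, AddHom.coe_mk, Complex.ofReal_cos,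
      Complex.ofReal_sin, Polynomial.Chebyshev.S_two_mul_complex_cos]
    simp
  have hbm' (j k : ℕ) : bm (1 + j + k) = cosMomentFunctional b hint (Polynomial.X ^ (j + k)) := by
    rw [hbm _ (by omega), show 1 + j + k - 1 = j + k by omega]
    simp only [cosMomentFunctional, LinearMap.coe_mk, AddHom.coe_mk, Polynomial.eval_pow,
      Polynomial.eval_X, mul_assoc]
  simp only [hc', hbm']
  exact Matrix.det_toeplitz_chebyshev_S _ N
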